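/- There exists a universal constant ã > 0 such that the following holds. Let n ≥ 3 and r be integers with 1 ≤ r and 2r ≤ n, let c ≥ 0 be real, and let k be a nonnegative integer satisfying k ≤ (1/4)·n·(log n − c) and, in case 2r < n, also k ≤ (n−2)·log(n/(n−2r)) + (1/2)·(n−2)·log(1 + (1/4)·(n−2)·(1 − ((n−2r)/n)²)·e^{−c}). Then (1/2)·C(n,r)^{1/2}·‖Q̃^{*k} − Ũ‖₂ ≥ ‖Q̃^{*k} − Ũ‖_TV ≥ 1 − ã·e^{−c}, where Q̃^{*k} is the probability measure induced on X by the k-fold convolution Q^{*k}. -/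

import Mathlib

open scoped Classical Pointwise

noncomputable section

namespace BL

/-- The subgroup of permutations of `Fin n` mapping `{0,…,r−1}` (the "first r positions")
to itself. -/
def blockSubgroup (n r : ℕ) : Subgroup (Equiv.Perm (Fin n)) :=
  MulAction.stabilizer (Equiv.Perm (Fin n)) ({ i : Fin n | (i : ℕ) < r } : Set (Fin n))

instance fintypeQuot {G : Type*} [Group G] [Fintype G] (H : Subgroup G) : Fintype (G ⧸ H) :=
  Fintype.ofFinite _

/-- Convolution of two (signed) measures on a finite group. -/
def conv {G : Type*} [Group G] [Fintype G] (μ ν : G → ℝ) : G → ℝ :=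
  fun g => ∑ h : G, μ h * ν (h⁻¹ * g)

/-- `k`-fold convolution power; `convPow μ 0` is the point mass at the identity. -/
def convPow {G : Type*} [Group G] [Fintype G] (μ : G → ℝ) : ℕ → G → ℝ
  | 0 => fun g => if g = 1 then 1 else 0
  | (k+1) => conv μ (convPow μ k)

/-- The measure induced on the left coset space `G ⧸ H`. -/
def induced {G : Type*} [Group G] [Fintype G] (H : Subgroup G) (μ : G → ℝ) :
    G ⧸ H → ℝ :=
  fun x => ∑ g : G, if (g : G ⧸ H) = x then μ g else 0

/-- Total variation distance. -/
def tv {X : Type*} [Fintype X] (μ ν : X → ℝ) : ℝ := (1/2) * ∑ x : X, |μ x - ν x|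

/-- ℓ² distance. -/
def l2 {X : Type*} [Fintype X] (μ ν : X → ℝ) : ℝ := Real.sqrt (∑ x : X, (μ x - ν x)^2)

/-- Uniform probability measure. -/
def unif (X : Type*) [Fintype X] : X → ℝ := fun _ => 1 / (Fintype.card X)

/-- `π = τκ` with `τ` a transposition crossing between the two blocks and `κ ∈ K`. -/
def crossProp (n r : ℕ) (π : Equiv.Perm (Fin n)) : Prop :=
  ∃ p q : Fin n, (p : ℕ) < r ∧ r ≤ (q : ℕ) ∧
    ∃ κ ∈ blockSubgroup n r, π = Equiv.swap p q * κ

/-- The Bernoulli–Laplace measure `P`. -/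
def P (n r : ℕ) : Equiv.Perm (Fin n) → ℝ := fun π =>
  if crossProp n r π then
    1 / ((r * (n - r) * (Nat.factorial r * Nat.factorial (n - r)) : ℕ) : ℝ)
  else 0

/-- The measure `Q` of the variant model. -/
def Q (n r : ℕ) : Equiv.Perm (Fin n) → ℝ := fun π =>
  if π ∈ blockSubgroup n r then
    ((n^2 - 2*r*(n-r) : ℕ) : ℝ) / ((n^2 * (Nat.factorial r * Nat.factorial (n - r)) : ℕ) : ℝ)
  else if crossProp n r π then
    2 / ((n^2 * (Nat.factorial r * Nat.factorial (n - r)) : ℕ) : ℝ)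
  else 0

section TotalVariation

variable {X : Type*} [Fintype X]

theorem tv_le_l2 (μ ν : X → ℝ) :
    tv μ ν ≤ (1/2) * Real.sqrt (Fintype.card X) * l2 μ ν := by
  have h := Real.sum_mul_le_sqrt_mul_sqrt Finset.univ (fun _ : X => (1 : ℝ))
    (fun x => |μ x - ν x|)
  simp only [one_mul, one_pow, sq_abs, Finset.sum_const, Finset.card_univ, nsmul_eq_mul,
    mul_one] at h
  unfold tv l2
  rw [mul_assoc]
  gcongr

/-- A second moment lower bound on the total variation distance. -/
theorem one_sub_le_tv_of_second_moment {μ ν : X → ℝ} (hμ : ∀ x, 0 ≤ μ x) (hν : ∀ x, 0 ≤ ν x)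
    (hμ1 : ∑ x, μ x = 1) (hν1 : ∑ x, ν x = 1) (f : X → ℝ) {m : ℝ} (hm : 0 < m) :
    1 - 4 / m ^ 2 * (∑ x, μ x * (f x - m) ^ 2 + ∑ x, ν x * f x ^ 2) ≤ tv μ ν := by
  have key : ∀ x, μ x + ν x - 2 * (4 / m ^ 2 * (μ x * (f x - m) ^ 2 + ν x * f x ^ 2)) ≤
      |μ x - ν x| := by
    intro x
    have h1 := mul_nonneg (hμ x) (sq_nonneg (f x - m))
    have h2 := mul_nonneg (hν x) (sq_nonneg (f x))
    have e : 4 / m ^ 2 * (μ x * (f x - m) ^ 2 + ν x * f x ^ 2) =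
        4 * (μ x * (f x - m) ^ 2 + ν x * f x ^ 2) / m ^ 2 := by ring
    rcases le_total (m / 2) (f x) with hf | hf
    · have h3 : m ^ 2 ≤ 4 * f x ^ 2 := by nlinarith
      have : ν x ≤ 4 / m ^ 2 * (μ x * (f x - m) ^ 2 + ν x * f x ^ 2) := by
        rw [e, le_div_iff₀ (by positivity)]
        nlinarith [mul_le_mul_of_nonneg_left h3 (hν x)]
      linarith [le_abs_self (μ x - ν x)]
    · have h3 : m ^ 2 ≤ 4 * (f x - m) ^ 2 := by nlinarith
      have : μ x ≤ 4 / m ^ 2 * (μ x * (f x - m) ^ 2 + ν x * f x ^ 2) := by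
        rw [e, le_div_iff₀ (by positivity)]
        nlinarith [mul_le_mul_of_nonneg_left h3 (hμ x)]
      linarith [neg_abs_le (μ x - ν x)]
  have h := Finset.sum_le_sum fun x (_ : x ∈ Finset.univ) => key x
  simp only [Finset.sum_sub_distrib, Finset.sum_add_distrib, ← Finset.mul_sum, hμ1, hν1] at h
  unfold tv
  linarith

end TotalVariation

section Group

variable {G : Type*} [Group G] [Fintype G]

theorem convPow_nonneg {μ : G → ℝ} (hμ : ∀ g, 0 ≤ μ g) (k : ℕ) (g : G) : 0 ≤ convPow μ k g := by
  induction k generalizing g with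
  | zero => simp only [convPow]; split_ifs <;> norm_num
  | succ k ih => exact Finset.sum_nonneg fun h _ => mul_nonneg (hμ h) (ih _)

/-- Eigenfunctions of right convolution by `μ` integrate to powers of the eigenvalue. -/
theorem sum_convPow_mul {μ : G → ℝ} {F : G → ℝ} {l : ℝ}
    (hF : ∀ g, ∑ h, μ h * F (g * h) = l * F g) (k : ℕ) (x : G) :
    ∑ g, convPow μ k g * F (x * g) = l ^ k * F x := by
  induction k generalizing x with
  | zero => simp [convPow]
  | succ k ih =>
    have h1 : ∀ h : G, ∑ g, convPow μ k (h⁻¹ * g) * F (x * g) = l ^ k * F (x * h) := by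
      intro h
      rw [← ih (x * h)]
      refine Fintype.sum_equiv (Equiv.mulLeft h⁻¹) _ _ fun g => ?_
      simp [mul_assoc]
    calc ∑ g, convPow μ (k + 1) g * F (x * g)
        = ∑ g, ∑ h, μ h * (convPow μ k (h⁻¹ * g) * F (x * g)) := by
          simp only [convPow, conv, Finset.sum_mul, mul_assoc]
      _ = ∑ h, μ h * (l ^ k * F (x * h)) := by
          rw [Finset.sum_comm]
          simp only [← Finset.mul_sum, h1]
      _ = l ^ k * ∑ h, μ h * F (x * h) := by
          rw [Finset.mul_sum]
          exact Finset.sum_congr rfl fun _ _ => by ring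
      _ = l ^ (k + 1) * F x := by rw [hF]; ring

/-- Eigenfunctions with eigenvalue other than `1` are orthogonal to constants. -/
theorem sum_eq_zero_of_eigenfunction {μ : G → ℝ} {F : G → ℝ} {l : ℝ} (hμ : ∑ g, μ g = 1)
    (hl : l ≠ 1) (hF : ∀ g, ∑ h, μ h * F (g * h) = l * F g) : ∑ g, F g = 0 := by
  have h1 : ∑ g, ∑ h, μ h * F (g * h) = ∑ g, F g := by
    rw [Finset.sum_comm]
    have : ∀ h : G, ∑ g, μ h * F (g * h) = μ h * ∑ g, F g := by
      intro h
      rw [← Finset.mul_sum]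
      congr 1
      exact Fintype.sum_equiv (Equiv.mulRight h) _ _ fun g => by simp
    simp only [this, ← Finset.sum_mul, hμ, one_mul]
  simp only [hF, ← Finset.mul_sum] at h1
  have h2 : (l - 1) * ∑ g, F g = 0 := by linarith
  exact (mul_eq_zero.1 h2).resolve_left (sub_ne_zero.2 hl)

variable (H : Subgroup G)

theorem sum_induced_mul (μ : G → ℝ) (f : G ⧸ H → ℝ) :
    ∑ x, induced H μ x * f x = ∑ g, μ g * f g := by
  simp only [induced, Finset.sum_mul, ite_mul, zero_mul]
  rw [Finset.sum_comm]
  simp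

theorem induced_nonneg {μ : G → ℝ} (hμ : ∀ g, 0 ≤ μ g) (x : G ⧸ H) : 0 ≤ induced H μ x :=
  Finset.sum_nonneg fun g _ => by split_ifs <;> simp [hμ]

theorem card_eq_card_quotient_mul_card : Fintype.card G = Fintype.card (G ⧸ H) * Nat.card H := by
  rw [← Nat.card_eq_fintype_card, ← Nat.card_eq_fintype_card]
  exact H.card_eq_card_quotient_mul_card_subgroup

theorem sum_unif_mul (f : G ⧸ H → ℝ) :
    ∑ x, unif (G ⧸ H) x * f x = (∑ g : G, f g) / Fintype.card G := by
  have h1 : ∑ g : G, f g = Nat.card H * ∑ x, f x := by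
    rw [← Fintype.sum_equiv (Subgroup.groupEquivQuotientProdSubgroup (s := H)).symm
      (fun p => f p.1) (fun g => f g) ?_]
    · rw [Fintype.sum_prod_type]
      simp [Finset.mul_sum]
    · intro p
      obtain ⟨q, rfl⟩ := (Subgroup.groupEquivQuotientProdSubgroup (s := H)).surjective p
      simp
      rfl
  have h2 : (Nat.card H : ℝ) ≠ 0 := by exact_mod_cast Nat.card_pos.ne'
  have h3 : (Fintype.card (G ⧸ H) : ℝ) ≠ 0 := by exact_mod_cast Fintype.card_ne_zero
  rw [h1, card_eq_card_quotient_mul_card H]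
  simp only [unif, ← Finset.mul_sum]
  push_cast
  field_simp

end Group

section BlockSubgroup

variable {n r : ℕ}

theorem mem_blockSubgroup_iff {π : Equiv.Perm (Fin n)} :
    π ∈ blockSubgroup n r ↔ ∀ i, ((π i : Fin n) : ℕ) < r ↔ (i : ℕ) < r := by
  rw [blockSubgroup, MulAction.mem_stabilizer_iff]
  constructor
  · intro h i
    have h1 := Set.smul_mem_smul_set_iff (a := π) (s := {i : Fin n | (i : ℕ) < r}) (x := i)
    rwa [h] at h1
  · intro h
    ext x
    rw [Set.mem_smul_set_iff_inv_smul_mem]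
    have h1 := h (π⁻¹ x)
    rw [show π (π⁻¹ x) = x by simp] at h1
    exact h1.symm

/-- The first `r` positions. -/
def low (n r : ℕ) : Finset (Fin n) := Finset.univ.filter fun i => (i : ℕ) < r

/-- The last `n - r` positions. -/
def high (n r : ℕ) : Finset (Fin n) := Finset.univ.filter fun i => r ≤ (i : ℕ)

theorem mem_low {i : Fin n} : i ∈ low n r ↔ (i : ℕ) < r := by simp [low]

theorem mem_high {i : Fin n} : i ∈ high n r ↔ r ≤ (i : ℕ) := by simp [high]

theorem low_compl : (low n r)ᶜ = high n r := by ext; simp [mem_low, mem_high]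

theorem card_low (h : r ≤ n) : (low n r).card = r := by
  rw [low, Fin.card_filter_val_lt]; omega

theorem card_high (h : r ≤ n) : (high n r).card = n - r := by
  rw [← low_compl, Finset.card_compl, card_low h, Fintype.card_fin]

theorem card_blockSubgroup (h : r ≤ n) :
    Nat.card (blockSubgroup n r) = Nat.factorial r * Nat.factorial (n - r) := by
  have h1 := DomMulAct.stabilizer_card (fun i : Fin n => decide ((i : ℕ) < r))
  have h2 : Nat.card (blockSubgroup n r) = Fintype.card {g : Equiv.Perm (Fin n) //
      (fun i : Fin n => decide ((i : ℕ) < r)) ∘ g = fun i : Fin n => decide ((i : ℕ) < r)} := by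
    rw [← Nat.card_eq_fintype_card]
    refine Nat.card_congr (Equiv.subtypeEquivRight fun g => ?_)
    rw [mem_blockSubgroup_iff, funext_iff]
    simp
  rw [h2, h1, Fintype.prod_bool]
  have h3 := card_low h
  have h4 := card_high h
  simp only [low, high] at h3 h4
  simp only [decide_eq_true_eq, decide_eq_false_iff_not, not_lt, Fintype.card_subtype]
  congr 2

theorem swap_mul_injective {p q p' q' : Fin n} {κ κ' : Equiv.Perm (Fin n)}
    (hp : (p : ℕ) < r) (hq : r ≤ (q : ℕ)) (hp' : (p' : ℕ) < r) (hq' : r ≤ (q' : ℕ))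
    (hκ : κ ∈ blockSubgroup n r) (hκ' : κ' ∈ blockSubgroup n r)
    (h : Equiv.swap p q * κ = Equiv.swap p' q' * κ') : p = p' ∧ q = q' ∧ κ = κ' := by
  rw [mem_blockSubgroup_iff] at hκ hκ'
  have key : ∀ x, ((Equiv.swap p q x : Fin n) : ℕ) < r ↔ ((Equiv.swap p' q' x : Fin n) : ℕ) < r := by
    intro x
    obtain ⟨y, rfl⟩ := (Equiv.swap p q * κ).surjective x
    have h1 := hκ y
    have h2 := hκ' y
    nth_rewrite 2 [h]
    simp [h1, h2]
  have hqq : q = q' := by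
    by_contra hne
    have h1 := key q
    rw [Equiv.swap_apply_right, Equiv.swap_apply_of_ne_of_ne (by rintro rfl; omega) hne] at h1
    omega
  have hpp : p = p' := by
    by_contra hne
    have h1 := key p
    rw [Equiv.swap_apply_left, Equiv.swap_apply_of_ne_of_ne hne (by rintro rfl; omega)] at h1
    omega
  subst hqq hpp
  exact ⟨rfl, rfl, mul_left_cancel h⟩

theorem not_mem_blockSubgroup_of_crossProp {π : Equiv.Perm (Fin n)} (h : crossProp n r π) :
    π ∉ blockSubgroup n r := by
  obtain ⟨p, q, hp, hq, κ, hκ, rfl⟩ := h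
  rw [mem_blockSubgroup_iff] at hκ ⊢
  intro h
  have h1 := h (κ⁻¹ p)
  have h2 := hκ (κ⁻¹ p)
  simp at h1 h2
  omega

theorem sum_blockSubgroup (h : r ≤ n) {φ : Equiv.Perm (Fin n) → ℝ}
    (hφ : ∀ g, ∀ κ ∈ blockSubgroup n r, φ (g * κ) = φ g) (g : Equiv.Perm (Fin n)) :
    ∑ κ ∈ Finset.univ.filter (· ∈ blockSubgroup n r), φ (g * κ) =
      (Nat.factorial r * Nat.factorial (n - r) : ℕ) * φ g := by
  rw [Finset.sum_congr rfl fun κ hκ => hφ g κ (Finset.mem_filter.1 hκ).2, Finset.sum_const,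
    nsmul_eq_mul, ← card_blockSubgroup h, Nat.card_eq_fintype_card, ← Fintype.card_subtype]

theorem sum_crossProp (h : r ≤ n) {φ : Equiv.Perm (Fin n) → ℝ}
    (hφ : ∀ g, ∀ κ ∈ blockSubgroup n r, φ (g * κ) = φ g) :
    ∑ π ∈ Finset.univ.filter (crossProp n r), φ π =
      (Nat.factorial r * Nat.factorial (n - r) : ℕ) *
        ∑ p ∈ low n r, ∑ q ∈ high n r, φ (Equiv.swap p q) := by
  have h1 : ∑ x ∈ low n r ×ˢ (high n r ×ˢ Finset.univ.filter (· ∈ blockSubgroup n r)),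
      φ (Equiv.swap x.1 x.2.1 * x.2.2) = ∑ π ∈ Finset.univ.filter (crossProp n r), φ π := by
    refine Finset.sum_bij (fun x _ => Equiv.swap x.1 x.2.1 * x.2.2) ?_ ?_ ?_ fun _ _ => rfl
    · rintro ⟨p, q, κ⟩ hx
      simp only [Finset.mem_product, mem_low, mem_high, Finset.mem_filter, Finset.mem_univ,
        true_and] at hx ⊢
      exact ⟨p, q, hx.1, hx.2.1, κ, hx.2.2, rfl⟩
    · rintro ⟨p, q, κ⟩ hx ⟨p', q', κ'⟩ hx' heq
      simp only [Finset.mem_product, mem_low, mem_high, Finset.mem_filter, Finset.mem_univ,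
        true_and] at hx hx'
      obtain ⟨rfl, rfl, rfl⟩ :=
        swap_mul_injective hx.1 hx.2.1 hx'.1 hx'.2.1 hx.2.2 hx'.2.2 heq
      rfl
    · intro π hπ
      obtain ⟨p, q, hp, hq, κ, hκ, rfl⟩ := (Finset.mem_filter.1 hπ).2
      exact ⟨(p, q, κ), by simp [mem_low, mem_high, hp, hq, hκ], rfl⟩
  rw [← h1, Finset.sum_product, Finset.mul_sum]
  refine Finset.sum_congr rfl fun p _ => ?_
  rw [Finset.sum_product, Finset.mul_sum]
  exact Finset.sum_congr rfl fun q _ => sum_blockSubgroup h hφ (Equiv.swap p q)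

theorem two_mul_mul_sub_le (h : r ≤ n) : 2 * r * (n - r) ≤ n ^ 2 := by
  obtain ⟨s, rfl⟩ := Nat.exists_eq_add_of_le h
  rw [Nat.add_sub_cancel_left]
  nlinarith [sq_nonneg r, sq_nonneg s]

theorem sum_Q_mul (hn : 0 < n) (h : r ≤ n) {φ : Equiv.Perm (Fin n) → ℝ}
    (hφ : ∀ g, ∀ κ ∈ blockSubgroup n r, φ (g * κ) = φ g) :
    ∑ π, Q n r π * φ π = (1 - 2 * r * ((n : ℝ) - r) / n ^ 2) * φ 1 +
      2 / n ^ 2 * ∑ p ∈ low n r, ∑ q ∈ high n r, φ (Equiv.swap p q) := by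
  have h0 : ∀ π, Q n r π * φ π =
      ((n^2 - 2*r*(n-r) : ℕ) : ℝ) / ((n^2 * (Nat.factorial r * Nat.factorial (n - r)) : ℕ) : ℝ) *
        (if π ∈ blockSubgroup n r then φ π else 0) +
      2 / ((n^2 * (Nat.factorial r * Nat.factorial (n - r)) : ℕ) : ℝ) *
        (if crossProp n r π then φ π else 0) := by
    intro π
    by_cases hc : crossProp n r π
    · simp [Q, hc, not_mem_blockSubgroup_of_crossProp hc]
    · by_cases hk : π ∈ blockSubgroup n r <;> simp [Q, hc, hk]
  have h1 := sum_blockSubgroup h hφ 1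
  simp only [one_mul] at h1
  simp only [h0, Finset.sum_add_distrib, ← Finset.mul_sum, ← Finset.sum_filter, h1,
    sum_crossProp h hφ]
  have h2 : ((Nat.factorial r * Nat.factorial (n - r) : ℕ) : ℝ) ≠ 0 := by positivity
  have h3 : (n : ℝ) ≠ 0 := by positivity
  rw [Nat.cast_mul (n ^ 2), Nat.cast_sub (two_mul_mul_sub_le h)]
  push_cast [Nat.cast_sub h] at h2 ⊢
  field_simp

theorem Q_nonneg (π : Equiv.Perm (Fin n)) : 0 ≤ Q n r π := by
  unfold Q
  split_ifs <;> positivity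

theorem sum_Q (hn : 0 < n) (h : r ≤ n) : ∑ π, Q n r π = 1 := by
  have h1 := sum_Q_mul hn h (φ := fun _ => 1) fun _ _ _ => rfl
  simp only [mul_one, Finset.sum_const, card_low h, card_high h, nsmul_eq_mul] at h1
  rw [h1, Nat.cast_sub h]
  have h3 : (n : ℝ) ≠ 0 := by positivity
  field_simp
  ring

/-- Indicator that the `i`-th position is sent into the second block. -/
def outside (r : ℕ) (g : Equiv.Perm (Fin n)) (i : Fin n) : ℝ := if r ≤ (g i : ℕ) then 1 else 0

theorem outside_mul (g h : Equiv.Perm (Fin n)) (i : Fin n) :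
    outside r (g * h) i = outside r g (h i) := rfl

/-- The number of positions of the first block sent into the second block. -/
def displaced (r : ℕ) (g : Equiv.Perm (Fin n)) : ℝ := ∑ i ∈ low n r, outside r g i

theorem displaced_mul_of_mem (g : Equiv.Perm (Fin n)) {κ : Equiv.Perm (Fin n)}
    (hκ : κ ∈ blockSubgroup n r) : displaced r (g * κ) = displaced r g := by
  rw [mem_blockSubgroup_iff] at hκ
  exact Finset.sum_equiv κ (fun i => by simp [mem_low, hκ]) fun i _ => outside_mul g κ i

theorem displaced_one : displaced r (1 : Equiv.Perm (Fin n)) = 0 :=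
  Finset.sum_eq_zero fun i hi => by
    rw [mem_low] at hi
    exact if_neg (not_le.2 hi)

theorem sum_high_outside (h : r ≤ n) (g : Equiv.Perm (Fin n)) :
    ∑ i ∈ high n r, outside r g i = (n : ℝ) - r - displaced r g := by
  have h1 : ∑ i, outside r g i = (n : ℝ) - r := by
    rw [Fintype.sum_equiv g (outside r g) (fun i => if r ≤ (i : ℕ) then 1 else 0)
      fun i => rfl, Finset.sum_ite, Finset.sum_const_zero, add_zero, Finset.sum_const, nsmul_eq_mul,
      mul_one, ← Nat.cast_sub h]
    exact congrArg Nat.cast (card_high h)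
  rw [← h1, displaced, ← low_compl, ← Finset.sum_add_sum_compl (low n r)]
  ring

theorem displaced_mul_swap (g : Equiv.Perm (Fin n)) {p q : Fin n} (hp : p ∈ low n r)
    (hq : q ∈ high n r) :
    displaced r (g * Equiv.swap p q) = displaced r g - outside r g p + outside r g q := by
  rw [displaced, displaced, ← Finset.add_sum_erase _ _ hp, ← Finset.add_sum_erase _ _ hp]
  have h1 : ∑ x ∈ (low n r).erase p, outside r (g * Equiv.swap p q) x =
      ∑ x ∈ (low n r).erase p, outside r g x := by
    refine Finset.sum_congr rfl fun x hx => ?_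
    rw [Finset.mem_erase, mem_low] at hx
    rw [mem_high] at hq
    rw [outside_mul, Equiv.swap_apply_of_ne_of_ne hx.1 (by rintro rfl; omega)]
  have h2 : outside r (g * Equiv.swap p q) p = outside r g q := by
    rw [outside_mul, Equiv.swap_apply_left]
  rw [h1, h2]
  ring

theorem sum_Q_mul_quadratic (hn : 0 < n) (h : r ≤ n) (g : Equiv.Perm (Fin n)) (α β γ : ℝ) :
    ∑ π, Q n r π * (α + β * displaced r (g * π) + γ * displaced r (g * π) ^ 2) =
      α + β * displaced r g + γ * displaced r g ^ 2 + 2 / n ^ 2 *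
        ((β + 2 * γ * displaced r g) * (r * ((n : ℝ) - r) - n * displaced r g) +
          γ * ((n - r) * displaced r g +
            (r - 2 * displaced r g) * ((n : ℝ) - r - displaced r g))) := by
  rw [sum_Q_mul hn h (φ := fun π => α + β * displaced r (g * π) + γ * displaced r (g * π) ^ 2)
    fun π κ hκ => by simp only [← mul_assoc, displaced_mul_of_mem _ hκ]]
  have hsq : ∀ i, outside r g i ^ 2 = outside r g i := by
    intro i; unfold outside; split_ifs <;> norm_num
  have h1 : ∀ p ∈ low n r, ∑ q ∈ high n r, (α + β * displaced r (g * Equiv.swap p q) +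
      γ * displaced r (g * Equiv.swap p q) ^ 2) =
      ((n : ℝ) - r) * (α + β * displaced r g + γ * displaced r g ^ 2) +
      (β + γ + 2 * γ * displaced r g) * ((n : ℝ) - r - displaced r g) +
      (((n : ℝ) - r) * (γ - β - 2 * γ * displaced r g) -
        2 * γ * ((n : ℝ) - r - displaced r g)) * outside r g p := by
    intro p hp
    have h2 : ∀ q ∈ high n r, (α + β * displaced r (g * Equiv.swap p q) +
      γ * displaced r (g * Equiv.swap p q) ^ 2) =
      (α + β * displaced r g + γ * displaced r g ^ 2 +
        (γ - β - 2 * γ * displaced r g) * outside r g p) +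
      (β + γ + 2 * γ * displaced r g - 2 * γ * outside r g p) * outside r g q := by
      intro q hq
      rw [displaced_mul_swap g hp hq]
      linear_combination γ * hsq p + γ * hsq q
    rw [Finset.sum_congr rfl h2, Finset.sum_add_distrib, ← Finset.mul_sum, sum_high_outside h,
      Finset.sum_const, card_high h, nsmul_eq_mul, Nat.cast_sub h]
    ring
  rw [Finset.sum_congr rfl h1, Finset.sum_add_distrib, ← Finset.mul_sum, Finset.sum_const,
    card_low h, nsmul_eq_mul, mul_one, ← displaced]
  have h3 : (n : ℝ) ≠ 0 := by positivity
  field_simp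
  ring

end BlockSubgroup

section Eigenfunctions

variable {n r : ℕ}

/-- The first nonconstant spherical function of the Bernoulli–Laplace chain. -/
def spherical (r : ℕ) (g : Equiv.Perm (Fin n)) : ℝ :=
  1 - n / (r * ((n : ℝ) - r)) * displaced r g

/-- The coefficient of `spherical` in the decomposition of its square into eigenfunctions. -/
def skew (n r : ℕ) : ℝ := ((n : ℝ) - 2 * r) ^ 2 / (r * ((n : ℝ) - r) * ((n : ℝ) - 2))

theorem sum_Q_mul_spherical (hr : 1 ≤ r) (hrn : r < n) (g : Equiv.Perm (Fin n)) :
    ∑ π, Q n r π * spherical r (g * π) = (1 - 2 / n : ℝ) * spherical r g := by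
  have h := sum_Q_mul_quadratic (by omega) hrn.le g 1 (-(n / (r * ((n : ℝ) - r)))) 0
  have h1 : (r : ℝ) ≠ 0 := by positivity
  have h2 : (n : ℝ) - r ≠ 0 := sub_ne_zero.2 (by exact_mod_cast hrn.ne')
  have h3 : (n : ℝ) ≠ 0 := Nat.cast_ne_zero.2 (by omega)
  simp only [zero_mul, add_zero] at h
  simp only [spherical, sub_eq_add_neg, ← neg_mul] at h ⊢
  rw [h]
  simp only [← sub_eq_add_neg] at h2 ⊢
  field_simp
  ring

/-- The part of the squared spherical function orthogonal to constants and to `spherical`. -/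
def sphericalSq (r : ℕ) (g : Equiv.Perm (Fin n)) : ℝ :=
  spherical r g ^ 2 - skew n r * spherical r g - 1 / ((n : ℝ) - 1)

theorem sum_Q_mul_sphericalSq (hn : 3 ≤ n) (hr : 1 ≤ r) (hrn : r < n) (g : Equiv.Perm (Fin n)) :
    ∑ π, Q n r π * sphericalSq r (g * π) = (1 - 2 / n : ℝ) ^ 2 * sphericalSq r g := by
  have h1 : (r : ℝ) ≠ 0 := by positivity
  have h2 : (n : ℝ) - r ≠ 0 := sub_ne_zero.2 (by exact_mod_cast hrn.ne')
  have hn' : (3 : ℝ) ≤ n := by exact_mod_cast hn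
  have h3 : (n : ℝ) ≠ 0 := by positivity
  have h4 : (n : ℝ) - 2 ≠ 0 := by linarith
  have h5 : (n : ℝ) - 1 ≠ 0 := by linarith
  have e : ∀ x : ℝ, (1 - n / (r * ((n : ℝ) - r)) * x) ^ 2 -
      skew n r * (1 - n / (r * ((n : ℝ) - r)) * x) - 1 / ((n : ℝ) - 1) =
      (1 - skew n r - 1 / ((n : ℝ) - 1)) +
        (skew n r - 2) * (n / (r * ((n : ℝ) - r))) * x +
        (n / (r * ((n : ℝ) - r))) ^ 2 * x ^ 2 := fun x => by ring
  simp only [sphericalSq, spherical, e]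
  rw [sum_Q_mul_quadratic (by omega) hrn.le]
  unfold skew
  field_simp
  ring

theorem spherical_one : spherical r (1 : Equiv.Perm (Fin n)) = 1 := by
  simp [spherical, displaced_one]

theorem sum_convPow_Q (hn : 0 < n) (hrn : r ≤ n) (k : ℕ) : ∑ g, convPow (Q n r) k g = 1 := by
  have h := sum_convPow_mul (μ := Q n r) (F := fun _ => 1) (l := 1)
    (fun g => by simp [sum_Q hn hrn]) k 1
  simpa using h

theorem sum_convPow_Q_mul_spherical (hr : 1 ≤ r) (hrn : r < n) (k : ℕ) :
    ∑ g, convPow (Q n r) k g * spherical r g = (1 - 2 / n : ℝ) ^ k := by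
  have h := sum_convPow_mul (sum_Q_mul_spherical hr hrn) k 1
  simpa [spherical_one] using h

theorem sum_convPow_Q_mul_sq (hn : 3 ≤ n) (hr : 1 ≤ r) (hrn : r < n) (k : ℕ) :
    ∑ g, convPow (Q n r) k g * (spherical r g - (1 - 2 / n : ℝ) ^ k) ^ 2 =
      (1 - ((1 - 2 / n : ℝ) ^ k) ^ 2) / ((n : ℝ) - 1) +
        skew n r * ((1 - 2 / n : ℝ) ^ k - ((1 - 2 / n : ℝ) ^ k) ^ 2) := by
  have h0 := sum_convPow_Q (r := r) (by omega : 0 < n) hrn.le k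
  have h1 := sum_convPow_Q_mul_spherical hr hrn k
  have h2 := sum_convPow_mul (sum_Q_mul_sphericalSq hn hr hrn) k 1
  simp only [one_mul] at h2
  have h3 : sphericalSq r (1 : Equiv.Perm (Fin n)) = 1 - skew n r - 1 / ((n : ℝ) - 1) := by
    simp [sphericalSq, spherical_one]
  rw [h3, ← pow_mul, mul_comm 2 k, pow_mul] at h2
  generalize (1 - 2 / n : ℝ) ^ k = m at *
  have e : ∀ g, convPow (Q n r) k g * (spherical r g - m) ^ 2 =
      convPow (Q n r) k g * sphericalSq r g +
      (skew n r - 2 * m) * (convPow (Q n r) k g * spherical r g) +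
      (1 / ((n : ℝ) - 1) + m ^ 2) * convPow (Q n r) k g := by
    intro g; unfold sphericalSq; ring
  simp only [e, Finset.sum_add_distrib, ← Finset.mul_sum, h0, h1, h2]
  ring

theorem sum_spherical_sq (hn : 3 ≤ n) (hr : 1 ≤ r) (hrn : r < n) :
    ∑ g : Equiv.Perm (Fin n), spherical r g ^ 2 =
      Fintype.card (Equiv.Perm (Fin n)) * (1 / ((n : ℝ) - 1)) := by
  have hn' : (3 : ℝ) ≤ n := by exact_mod_cast hn
  have hpos : (0 : ℝ) < 2 / n := by positivity
  have hle : (2 : ℝ) / n < 1 := by rw [div_lt_one (by positivity)]; linarith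
  have h1 := sum_eq_zero_of_eigenfunction (sum_Q (by omega) hrn.le) (by linarith)
    (sum_Q_mul_spherical hr hrn)
  have h2 := sum_eq_zero_of_eigenfunction (sum_Q (by omega) hrn.le) (by nlinarith)
    (sum_Q_mul_sphericalSq hn hr hrn)
  simp only [sphericalSq, Finset.sum_sub_distrib, ← Finset.mul_sum, h1, Finset.sum_const,
    Finset.card_univ, nsmul_eq_mul] at h2
  linarith

theorem spherical_mul_of_mem (g : Equiv.Perm (Fin n)) {κ : Equiv.Perm (Fin n)}
    (hκ : κ ∈ blockSubgroup n r) : spherical r (g * κ) = spherical r g := by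
  rw [spherical, spherical, displaced_mul_of_mem g hκ]

theorem spherical_out (g : Equiv.Perm (Fin n)) :
    spherical r (g : Equiv.Perm (Fin n) ⧸ blockSubgroup n r).out = spherical r g := by
  obtain ⟨κ, hκ⟩ := QuotientGroup.mk_out_eq_mul (blockSubgroup n r) g
  rw [hκ, spherical_mul_of_mem g κ.2]

theorem card_quotient_blockSubgroup (h : r ≤ n) :
    Fintype.card (Equiv.Perm (Fin n) ⧸ blockSubgroup n r) = n.choose r := by
  have h1 := card_eq_card_quotient_mul_card (blockSubgroup n r)
  rw [card_blockSubgroup h, Fintype.card_perm, Fintype.card_fin,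
    ← Nat.choose_mul_factorial_mul_factorial h, mul_assoc] at h1
  exact (Nat.eq_of_mul_eq_mul_right (by positivity) h1).symm

theorem skew_nonneg (hn : 3 ≤ n) (hrn : r ≤ n) : 0 ≤ skew n r := by
  have hn' : (3 : ℝ) ≤ n := by exact_mod_cast hn
  have h : (r : ℝ) ≤ n := by exact_mod_cast hrn
  exact div_nonneg (sq_nonneg _)
    (mul_nonneg (mul_nonneg (by positivity) (by linarith)) (by linarith))

theorem one_sub_two_div_pow_pos (hn : 3 ≤ n) (k : ℕ) : 0 < (1 - 2 / n : ℝ) ^ k := by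
  have hn' : (3 : ℝ) ≤ n := by exact_mod_cast hn
  have hle : (2 : ℝ) / n < 1 := by rw [div_lt_one (by positivity)]; linarith
  exact pow_pos (by linarith) k

theorem one_sub_le_tv_convPow_Q (hn : 3 ≤ n) (hr : 1 ≤ r) (hrn : r < n) (k : ℕ) :
    1 - 4 * (2 / (((n : ℝ) - 1) * ((1 - 2 / n : ℝ) ^ k) ^ 2) +
        skew n r * (((1 - 2 / n : ℝ) ^ k)⁻¹ - 1)) ≤
      tv (induced (blockSubgroup n r) (convPow (Q n r) k))
        (unif (Equiv.Perm (Fin n) ⧸ blockSubgroup n r)) := by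
  have hm := one_sub_two_div_pow_pos hn k
  have hμ : ∀ x, 0 ≤ induced (blockSubgroup n r) (convPow (Q n r) k) x :=
    induced_nonneg _ (convPow_nonneg Q_nonneg k)
  have hν : ∀ x, 0 ≤ unif (Equiv.Perm (Fin n) ⧸ blockSubgroup n r) x := fun x => by
    unfold unif; positivity
  have hμ1 := sum_induced_mul (blockSubgroup n r) (convPow (Q n r) k) fun _ => 1
  have hν1 := sum_unif_mul (blockSubgroup n r) fun _ => 1
  have hμ2 := sum_induced_mul (blockSubgroup n r) (convPow (Q n r) k)
    fun x => (spherical r x.out - (1 - 2 / n : ℝ) ^ k) ^ 2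
  have hν2 := sum_unif_mul (blockSubgroup n r) fun x => spherical r x.out ^ 2
  have hG : (Fintype.card (Equiv.Perm (Fin n)) : ℝ) ≠ 0 := by exact_mod_cast Fintype.card_ne_zero
  simp only [mul_one, sum_convPow_Q (by omega : 0 < n) hrn.le] at hμ1
  simp only [mul_one, Finset.sum_const, Finset.card_univ, nsmul_eq_mul, div_self hG] at hν1
  simp only [spherical_out, sum_convPow_Q_mul_sq hn hr hrn] at hμ2
  simp only [spherical_out, sum_spherical_sq hn hr hrn, mul_div_cancel_left₀ _ hG] at hν2
  have key := one_sub_le_tv_of_second_moment hμ hν hμ1 hν1 (fun x => spherical r x.out) hm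
  rw [hμ2, hν2] at key
  refine le_trans ?_ key
  generalize (1 - 2 / n : ℝ) ^ k = m at *
  have hn' : (3 : ℝ) ≤ n := by exact_mod_cast hn
  have h5 : (0 : ℝ) < (n : ℝ) - 1 := by linarith
  have e : 4 / m ^ 2 * ((1 - m ^ 2) / ((n : ℝ) - 1) + skew n r * (m - m ^ 2) + 1 / ((n : ℝ) - 1)) =
      4 * (2 / (((n : ℝ) - 1) * m ^ 2) + skew n r * (m⁻¹ - 1)) - 4 / ((n : ℝ) - 1) := by
    field_simp
    ring
  rw [e]
  have : 0 < 4 / ((n : ℝ) - 1) := by positivity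
  linarith

end Eigenfunctions

section Estimates

variable {n r : ℕ}

theorem inv_one_sub_two_div_pow_le (hn : 3 ≤ n) (k : ℕ) :
    ((1 - 2 / n : ℝ) ^ k)⁻¹ ≤ Real.exp (2 * k / ((n : ℝ) - 2)) := by
  have hn' : (3 : ℝ) ≤ n := by exact_mod_cast hn
  have h2 : (0 : ℝ) < (n : ℝ) - 2 := by linarith
  have e : (1 - 2 / n : ℝ)⁻¹ = 2 / ((n : ℝ) - 2) + 1 := by
    rw [one_sub_div (by positivity), inv_div]
    field_simp
    ring
  rw [← inv_pow, e]
  calc (2 / ((n : ℝ) - 2) + 1) ^ k ≤ Real.exp (2 / ((n : ℝ) - 2)) ^ k := by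
        gcongr
        exact Real.add_one_le_exp _
    _ = _ := by rw [← Real.exp_nat_mul]; congr 1; ring

theorem two_div_mul_sq_le (hn : 3 ≤ n) {c : ℝ} (hc : 0 ≤ c) {k : ℕ}
    (hk : (k : ℝ) ≤ (1/4 : ℝ) * n * (Real.log n - c)) :
    2 / (((n : ℝ) - 1) * ((1 - 2 / n : ℝ) ^ k) ^ 2) ≤ 3 * Real.exp 4 * Real.exp (-c) := by
  have hn' : (3 : ℝ) ≤ n := by exact_mod_cast hn
  have h1 : (0 : ℝ) < (n : ℝ) - 1 := by linarith
  have h2 : (0 : ℝ) < (n : ℝ) - 2 := by linarith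
  have h0 : (0 : ℝ) < n := by linarith
  have hlog : Real.log n ≤ n - 1 := Real.log_le_sub_one_of_pos h0
  have hexp : 2 * (2 * k / ((n : ℝ) - 2)) ≤ Real.log n + (4 + -c) := by
    rw [← mul_div_assoc, div_le_iff₀ h2]
    nlinarith
  have hm := inv_one_sub_two_div_pow_le hn k
  have hm0 := one_sub_two_div_pow_pos hn k
  have hsq : (((1 - 2 / n : ℝ) ^ k)⁻¹) ^ 2 ≤ n * (Real.exp 4 * Real.exp (-c)) := by
    calc (((1 - 2 / n : ℝ) ^ k)⁻¹) ^ 2 ≤ Real.exp (2 * k / ((n : ℝ) - 2)) ^ 2 := by gcongr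
      _ = Real.exp (2 * (2 * k / ((n : ℝ) - 2))) := by rw [← Real.exp_nat_mul]; norm_num
      _ ≤ Real.exp (Real.log n + (4 + -c)) := Real.exp_le_exp.2 hexp
      _ = _ := by rw [Real.exp_add, Real.exp_log h0, Real.exp_add]
  have e : 2 / (((n : ℝ) - 1) * ((1 - 2 / n : ℝ) ^ k) ^ 2) =
      2 * (((1 - 2 / n : ℝ) ^ k)⁻¹) ^ 2 / ((n : ℝ) - 1) := by
    field_simp
  rw [e, div_le_iff₀ h1]
  have : 0 < Real.exp 4 * Real.exp (-c) := by positivity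
  nlinarith

theorem one_div_le_exp_neg (hn : 3 ≤ n) {c : ℝ} {k : ℕ}
    (hk : (k : ℝ) ≤ (1/4 : ℝ) * n * (Real.log n - c)) : 1 / (n : ℝ) ≤ Real.exp (-c) := by
  have h0 : (0 : ℝ) < n := by positivity
  have h1 : (0 : ℝ) ≤ (1/4 : ℝ) * n * (Real.log n - c) := le_trans (by positivity) hk
  have h2 : c ≤ Real.log n := by
    have := nonneg_of_mul_nonneg_right h1 (by positivity)
    linarith
  calc 1 / (n : ℝ) = Real.exp (-Real.log n) := by rw [Real.exp_neg, Real.exp_log h0, one_div]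
    _ ≤ _ := Real.exp_le_exp.2 (by linarith)

theorem skew_mul_inv_sub_one_le (hn : 3 ≤ n) (hr : 1 ≤ r) (hrn : 2 * r < n) {c : ℝ} {k : ℕ}
    (hk : (k : ℝ) ≤ ((n : ℝ) - 2) * Real.log ((n : ℝ) / ((n : ℝ) - 2*r)) +
      (1/2 : ℝ) * ((n : ℝ) - 2) * Real.log (1 + (1/4 : ℝ) * ((n : ℝ) - 2) *
        (1 - (((n : ℝ) - 2*r) / n)^2) * Real.exp (-c))) :
    skew n r * (((1 - 2 / n : ℝ) ^ k)⁻¹ - 1) ≤ 4 / ((n : ℝ) - 2) + Real.exp (-c) := by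
  have hn' : (3 : ℝ) ≤ n := by exact_mod_cast hn
  have hr' : (1 : ℝ) ≤ r := by exact_mod_cast hr
  have hrn' : 2 * (r : ℝ) < n := by exact_mod_cast hrn
  have h0 : (0 : ℝ) < n := by linarith
  have h2 : (0 : ℝ) < (n : ℝ) - 2 := by linarith
  have h3 : (0 : ℝ) < (n : ℝ) - 2 * r := by linarith
  have h4 : (0 : ℝ) < (n : ℝ) - r := by linarith
  have h5 : (0 : ℝ) < r := by linarith
  have eY : (1/4 : ℝ) * ((n : ℝ) - 2) * (1 - (((n : ℝ) - 2*r) / n)^2) * Real.exp (-c) =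
      ((n : ℝ) - 2) * (r * ((n : ℝ) - r)) / n ^ 2 * Real.exp (-c) := by
    field_simp
    ring
  rw [eY] at hk
  set Y := ((n : ℝ) - 2) * (r * ((n : ℝ) - r)) / n ^ 2 * Real.exp (-c) with hY
  have hY0 : 0 < Y := by positivity
  have hexp : 2 * k / ((n : ℝ) - 2) ≤
      2 * Real.log ((n : ℝ) / ((n : ℝ) - 2*r)) + Real.log (1 + Y) := by
    rw [div_le_iff₀ h2]
    linarith
  have hinv : ((1 - 2 / n : ℝ) ^ k)⁻¹ ≤ ((n : ℝ) / ((n : ℝ) - 2*r)) ^ 2 * (1 + Y) := by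
    calc _ ≤ _ := inv_one_sub_two_div_pow_le hn k
      _ ≤ _ := Real.exp_le_exp.2 hexp
      _ = _ := by
        rw [Real.exp_add, Real.exp_log (by positivity), mul_comm 2, Real.exp_mul,
          Real.exp_log (by positivity)]
        norm_num
  calc skew n r * (((1 - 2 / n : ℝ) ^ k)⁻¹ - 1)
      ≤ skew n r * (((n : ℝ) / ((n : ℝ) - 2*r)) ^ 2 * (1 + Y) - 1) := by
        gcongr
        exact skew_nonneg hn (by omega)
    _ = 4 / ((n : ℝ) - 2) + Real.exp (-c) := by
        rw [hY, skew]
        field_simp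
        ring

end Estimates

/-- lower bound, Theorem 2.5.5: there is a universal constant
`ã > 0` such that for `n ≥ 3`, `1 ≤ r`, `2r ≤ n`, `c ≥ 0` and any nonnegative integer
`k` with `k ≤ (1/4)·n·(log n − c)` and (in case `2r < n`) also
`k ≤ (n−2)·log(n/(n−2r)) + (1/2)(n−2)·log(1 + (1/4)(n−2)(1 − ((n−2r)/n)²)e^{−c})`,
one has `(1/2)·C(n,r)^{1/2}·‖Q̃^{*k} − Ũ‖₂ ≥ ‖Q̃^{*k} − Ũ‖_TV ≥ 1 − ã·e^{−c}`. -/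
theorem variant_lower_bound :
    ∃ a : ℝ, 0 < a ∧
      ∀ (n r : ℕ), 3 ≤ n → 1 ≤ r → 2 * r ≤ n → ∀ c : ℝ, 0 ≤ c → ∀ k : ℕ,
        (k : ℝ) ≤ (1/4 : ℝ) * n * (Real.log n - c) →
        (2 * r < n →
          (k : ℝ) ≤ ((n : ℝ) - 2) * Real.log ((n : ℝ) / ((n : ℝ) - 2*r)) +
            (1/2 : ℝ) * ((n : ℝ) - 2) *
              Real.log (1 + (1/4 : ℝ) * ((n : ℝ) - 2) *
                (1 - (((n : ℝ) - 2*r) / n)^2) * Real.exp (-c))) →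
        1 - a * Real.exp (-c) ≤
            tv (induced (blockSubgroup n r) (convPow (Q n r) k))
              (unif (Equiv.Perm (Fin n) ⧸ blockSubgroup n r)) ∧
          tv (induced (blockSubgroup n r) (convPow (Q n r) k))
              (unif (Equiv.Perm (Fin n) ⧸ blockSubgroup n r)) ≤
            (1/2) * Real.sqrt (n.choose r) *
              l2 (induced (blockSubgroup n r) (convPow (Q n r) k))
                (unif (Equiv.Perm (Fin n) ⧸ blockSubgroup n r)) := by
  refine ⟨4 * (3 * Real.exp 4 + 13), by positivity, fun n r hn hr hrn c hc k hk hk2 => ⟨?_, ?_⟩⟩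
  · refine le_trans ?_ (one_sub_le_tv_convPow_Q hn hr (by omega) k)
    have h1 := two_div_mul_sq_le hn hc hk
    have h2 : skew n r * (((1 - 2 / n : ℝ) ^ k)⁻¹ - 1) ≤ 13 * Real.exp (-c) := by
      rcases hrn.lt_or_eq with hlt | heq
      · refine (skew_mul_inv_sub_one_le hn hr hlt (hk2 hlt)).trans ?_
        have hn' : (3 : ℝ) ≤ n := by exact_mod_cast hn
        have h3 := one_div_le_exp_neg hn hk
        have h4 : 4 / ((n : ℝ) - 2) ≤ 12 * (1 / n) := by
          rw [mul_one_div, div_le_div_iff₀ (by linarith) (by linarith)]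
          linarith
        linarith
      · have h3 : skew n r = 0 := by
          have : (n : ℝ) - 2 * r = 0 := by rw [← heq]; push_cast; ring
          rw [skew, this]
          simp
        rw [h3, zero_mul]
        positivity
    linarith
  · rw [← card_quotient_blockSubgroup (by omega : r ≤ n)]
    exact tv_le_l2 _ _

end BL
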